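/- arXiv:2010.15983 — 5 statements merged into one kernel-verified Lean document; each statement's English description precedes it below -/
import Mathlib

section
/- Let A, B, Q, R ∈ ℝ with A ≠ 0, B ≠ 0, R > 0, Q > 0, and let P* be the unique positive solution of the scalar DARE P = A²P − A²B²P²/(B²P + R) + Q. On the set D = {P > 0 : B²P + R > |A|R}, which contains P*, the scalar Newton-Hewer map f(P) = (A²B²P²R + Q(B²P+R)²)/((B²P+R)² − A²R²) is strictly decreasing on {P ∈ D : P < P*} and strictly increasing on {P ∈ D : P > P*}. -/
/-- The difference of two values of the scalar Newton-Hewer map, factored through a nonzero root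
`S` of the cleared DARE `S * (b * S + R) = a * S * R + Q * (b * S + R)`. -/
theorem newton_hewer_sub (a b Q R S x y : ℝ) (hS : S ≠ 0)
    (hroot : S * (b * S + R) = a * S * R + Q * (b * S + R))
    (hx : (b * x + R) ^ 2 - a * R ^ 2 ≠ 0) (hy : (b * y + R) ^ 2 - a * R ^ 2 ≠ 0) :
    (a * b * y ^ 2 * R + Q * (b * y + R) ^ 2) / ((b * y + R) ^ 2 - a * R ^ 2) -
      (a * b * x ^ 2 * R + Q * (b * x + R) ^ 2) / ((b * x + R) ^ 2 - a * R ^ 2) =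
    a * b * R ^ 2 * (y - x) *
      (b * S * (x * (y - S) + y * (x - S)) + Q * R * ((x - S) + (y - S))) /
      (S * (((b * y + R) ^ 2 - a * R ^ 2) * ((b * x + R) ^ 2 - a * R ^ 2))) := by
  rw [div_sub_div _ _ hy hx, div_eq_div_iff (mul_ne_zero hy hx)
    (mul_ne_zero hS (mul_ne_zero hy hx))]
  linear_combination (a * b * R ^ 2 * (y - x) * (x + y) *
    (((b * y + R) ^ 2 - a * R ^ 2) * ((b * x + R) ^ 2 - a * R ^ 2))) * hroot

open Set in
/-- On the set `D = {P > 0 : B^2*P + R > |A| * R}`, which contains the unique positive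
DARE solution `P*`, the scalar Newton-Hewer map is strictly decreasing below `P*` and
strictly increasing above `P*`. -/
theorem newton_hewer_monotonicity_around_dare_solution
    (A B Q R : ℝ) (hA : A ≠ 0) (hB : B ≠ 0) (hR : 0 < R) (hQ : 0 < Q)
    (Pstar : ℝ)
    (hPstar : 0 < Pstar ∧ Pstar = A^2*Pstar - A^2*B^2*Pstar^2/(B^2*Pstar + R) + Q)
    (huniq : ∀ P : ℝ, 0 < P → P = A^2*P - A^2*B^2*P^2/(B^2*P + R) + Q → P = Pstar)
    (f : ℝ → ℝ)
    (hf : ∀ P : ℝ, f P = (A^2*B^2*P^2*R + Q*(B^2*P + R)^2)/((B^2*P + R)^2 - A^2*R^2))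
    (D : Set ℝ) (hD : D = {P : ℝ | 0 < P ∧ B^2*P + R > |A| * R}) :
    Pstar ∈ D ∧
    StrictAntiOn f {P ∈ D | P < Pstar} ∧
    StrictMonoOn f {P ∈ D | Pstar < P} := by
  obtain ⟨hS, hdare⟩ := hPstar
  have hb : 0 < B ^ 2 := by positivity
  have ha : 0 < A ^ 2 := by positivity
  have hXS : 0 < B ^ 2 * Pstar + R := by positivity
  have hroot : Pstar * (B ^ 2 * Pstar + R) =
      A ^ 2 * Pstar * R + Q * (B ^ 2 * Pstar + R) := by
    field_simp at hdare
    linear_combination hdare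
  have hden : ∀ P ∈ D, 0 < (B ^ 2 * P + R) ^ 2 - A ^ 2 * R ^ 2 := by
    intro P hP
    rw [hD] at hP
    have h := pow_lt_pow_left₀ hP.2 (by positivity) two_ne_zero
    rw [mul_pow, sq_abs] at h
    linarith
  have hpos : ∀ P ∈ D, 0 < P := by
    intro P hP
    rw [hD] at hP
    exact hP.1
  refine ⟨?_, ?_, ?_⟩
  · rw [hD]
    refine ⟨hS, ?_⟩
    have hgt : A ^ 2 * R < B ^ 2 * Pstar + R := by
      have : 0 < Q * (B ^ 2 * Pstar + R) := by positivity
      refine lt_of_mul_lt_mul_left (a := Pstar) ?_ hS.le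
      linarith
    rcases le_total |A| 1 with h | h
    · have := mul_le_mul_of_nonneg_right h hR.le
      have : 0 < B ^ 2 * Pstar := by positivity
      linarith
    · have : |A| ≤ A ^ 2 := by
        rw [← sq_abs]
        nlinarith
      have := mul_le_mul_of_nonneg_right this hR.le
      linarith
  · rintro x ⟨hx, hxS⟩ y ⟨hy, hyS⟩ hxy
    have hdx := hden x hx
    have hdy := hden y hy
    rw [← sub_neg, hf, hf,
      newton_hewer_sub (A ^ 2) (B ^ 2) Q R Pstar x y hS.ne' hroot hdx.ne' hdy.ne']
    refine div_neg_of_neg_of_pos (mul_neg_of_pos_of_neg ?_ ?_) (by positivity)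
    · have := sub_pos.2 hxy
      positivity
    · have h₁ := mul_neg_of_pos_of_neg (hpos x hx) (sub_neg.2 hyS)
      have h₂ := mul_neg_of_pos_of_neg (hpos y hy) (sub_neg.2 hxS)
      exact add_neg (mul_neg_of_pos_of_neg (by positivity) (add_neg h₁ h₂))
        (mul_neg_of_pos_of_neg (by positivity) (add_neg (sub_neg.2 hxS) (sub_neg.2 hyS)))
  · rintro x ⟨hx, hxS⟩ y ⟨hy, hyS⟩ hxy
    have hdx := hden x hx
    have hdy := hden y hy
    rw [← sub_pos, hf, hf,
      newton_hewer_sub (A ^ 2) (B ^ 2) Q R Pstar x y hS.ne' hroot hdx.ne' hdy.ne']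
    have := sub_pos.2 hxy
    have := sub_pos.2 hxS
    have := sub_pos.2 hyS
    have := hpos x hx
    have := hpos y hy
    positivity
end

section
/- Let A, B, Q, R ∈ ℝ with B ≠ 0, R > 0, Q > 0, let P* be the unique positive solution of the scalar DARE, and let f be the scalar Newton-Hewer map f(P) = (A²B²P²R + Q(B²P+R)²)/((B²P+R)² − A²R²). If P ≥ P*, then (B²P + R)² > A²R² (so f(P) is well defined) and P ≥ f(P) ≥ P*. In particular, one Newton-Hewer step from any point at or above P* stays at or above P* and does not increase. -/
/-- One Newton-Hewer step from any point at or above the unique positive DARE solution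
`P*` is well defined, stays at or above `P*`, and does not increase. -/
theorem newton_hewer_step_above_dare_solution
    (A B Q R : ℝ) (hB : B ≠ 0) (hR : 0 < R) (hQ : 0 < Q)
    (Pstar : ℝ)
    (hPstar : 0 < Pstar ∧ Pstar = A^2*Pstar - A^2*B^2*Pstar^2/(B^2*Pstar + R) + Q)
    (huniq : ∀ P : ℝ, 0 < P → P = A^2*P - A^2*B^2*P^2/(B^2*P + R) + Q → P = Pstar)
    (f : ℝ → ℝ)
    (hf : ∀ P : ℝ, f P = (A^2*B^2*P^2*R + Q*(B^2*P + R)^2)/((B^2*P + R)^2 - A^2*R^2)) :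
    ∀ P : ℝ, P ≥ Pstar → (B^2*P + R)^2 > A^2*R^2 ∧ P ≥ f P ∧ f P ≥ Pstar := by
  obtain ⟨hs, hdare⟩ := hPstar
  intro P hP
  have hb : 0 < B^2 := by positivity
  have hP0 : 0 < P := hs.trans_le hP
  have hd : 0 < B^2*Pstar + R := by positivity
  have hD : 0 < B^2*P + R := by positivity
  have hdare' : Pstar*(B^2*Pstar + R) = A^2*Pstar*R + Q*(B^2*Pstar + R) := by
    field_simp at hdare
    linear_combination hdare
  have hAR : A^2*R < B^2*Pstar + R := by
    refine lt_of_mul_lt_mul_left ?_ hs.le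
    linarith [mul_pos hQ hd]
  have hdD : B^2*Pstar + R ≤ B^2*P + R := by gcongr
  have hden : A^2*R^2 < (B^2*P + R)^2 := by
    calc A^2*R^2 = A^2*R*R := by ring
      _ < (B^2*Pstar + R)*R := by gcongr
      _ ≤ (B^2*P + R)*(B^2*P + R) := by
        gcongr
        linarith [mul_pos hb hP0]
      _ = (B^2*P + R)^2 := by ring
  have hden' : 0 < (B^2*P + R)^2 - A^2*R^2 := sub_pos.2 hden
  refine ⟨hden, ?_, ?_⟩
  · -- `P * denominator - numerator = (B²P + R) * g P` with `g` the DARE quadratic.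
    have hg : 0 ≤ P*(B^2*P + R) - A^2*R*P - Q*(B^2*P + R) := by
      refine (mul_nonneg_iff_of_pos_left hs).1 ?_
      have h : 0 ≤ (B^2*Pstar*P + Q*R)*(P - Pstar) :=
        mul_nonneg (by positivity) (sub_nonneg.2 hP)
      linear_combination h - P*hdare'
    rw [hf, ge_iff_le, div_le_iff₀ hden']
    linear_combination mul_nonneg hD.le hg
  · -- `(B²P* + R) * (numerator - P* * denominator) = A²B²R²(P - P*)²`.
    rw [hf, ge_iff_le, le_div_iff₀ hden']
    refine le_of_mul_le_mul_left ?_ hd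
    have h : 0 ≤ A^2*B^2*R^2*(P - Pstar)^2 := by positivity
    linear_combination h + (B^2*P + R)^2*hdare'
end

section
/- Let A, B, Q, R ∈ ℝ with B ≠ 0, R > 0, Q > 0, let P* be the unique positive solution of the scalar DARE, and let f be the scalar Newton-Hewer map. If P₁ ≥ P* and P_{t+1} = f(P_t) for all t ≥ 1, then the sequence (P_t) is nonincreasing, bounded below by P*, and converges to P* (scalar version of Hewer's monotone convergence theorem). -/
/-- One Newton-Hewer step from `x ≥ s`, where `s` is a positive root of the scalar DARE with
denominators cleared and `b = B ^ 2`: the step stays above `s`, does not increase `x`, and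
contracts the distance to `s` by the factor `R / (b * s + R)`. -/
theorem newton_hewer_step {a b Q R s x : ℝ} (ha : 0 ≤ a) (hb : 0 < b) (hR : 0 < R) (hQ : 0 < Q)
    (hs : 0 < s) (hdare : s * (b * s + R) = a * s * R + Q * (b * s + R)) (hx : s ≤ x) :
    s ≤ (a * b * x ^ 2 * R + Q * (b * x + R) ^ 2) / ((b * x + R) ^ 2 - a * R ^ 2) ∧
    (a * b * x ^ 2 * R + Q * (b * x + R) ^ 2) / ((b * x + R) ^ 2 - a * R ^ 2) ≤ x ∧
    (a * b * x ^ 2 * R + Q * (b * x + R) ^ 2) / ((b * x + R) ^ 2 - a * R ^ 2) - s ≤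
      R / (b * s + R) * (x - s) := by
  have hS : 0 < b * s + R := by positivity
  have hST : b * s + R ≤ b * x + R := by gcongr
  have hT : 0 < b * x + R := hS.trans_le hST
  have hgap : a * R < b * s + R := by
    have : 0 < s * (b * s + R - a * R) := by
      have : 0 < Q * (b * s + R) := by positivity
      linarith
    linarith [pos_of_mul_pos_right this hs.le]
  have hDs : 0 < (b * s + R) ^ 2 - a * R ^ 2 := by
    have h : s * ((b * s + R) ^ 2 - a * R ^ 2) = a * b * s ^ 2 * R + Q * (b * s + R) ^ 2 := by
      linear_combination (b * s + R) * hdare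
    have : 0 < s * ((b * s + R) ^ 2 - a * R ^ 2) := by rw [h]; positivity
    exact pos_of_mul_pos_right this hs.le
  have hD : 0 < (b * x + R) ^ 2 - a * R ^ 2 := by
    have : (b * s + R) ^ 2 ≤ (b * x + R) ^ 2 := by gcongr
    linarith
  have hcoef : (a * R + Q * b - s * b) * (b * s + R) = a * R ^ 2 := by
    linear_combination -b * hdare
  have herr : a * b * x ^ 2 * R + Q * (b * x + R) ^ 2 - s * ((b * x + R) ^ 2 - a * R ^ 2) =
      b * a * R ^ 2 * (x - s) ^ 2 / (b * s + R) := by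
    rw [eq_div_iff hS.ne']
    have hconst : a * b * s ^ 2 * R + Q * (b * s + R) ^ 2 = s * ((b * s + R) ^ 2 - a * R ^ 2) := by
      linear_combination -(b * s + R) * hdare
    linear_combination b * (x - s) ^ 2 * hcoef +
      (b * s + R) * hconst - 2 * b * (x - s) * (b * s + R) * hdare
  refine ⟨?_, ?_, ?_⟩
  · rw [le_div_iff₀ hD]
    have : 0 ≤ b * a * R ^ 2 * (x - s) ^ 2 / (b * s + R) := by positivity
    linarith
  · rw [div_le_iff₀ hD]
    have h : s * (x * ((b * x + R) ^ 2 - a * R ^ 2) -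
        (a * b * x ^ 2 * R + Q * (b * x + R) ^ 2)) =
        (b * x + R) * ((x - s) * (b * s * x + Q * R)) := by
      linear_combination x * (b * x + R) * hdare
    have hpos : 0 ≤ (b * x + R) * ((x - s) * (b * s * x + Q * R)) := by
      have hx0 : 0 < x := hs.trans_le hx
      have := sub_nonneg.2 hx
      positivity
    rw [← h] at hpos
    linarith [nonneg_of_mul_nonneg_right hpos hs]
  · have hstep : (a * b * x ^ 2 * R + Q * (b * x + R) ^ 2) / ((b * x + R) ^ 2 - a * R ^ 2) - s =
        b * a * R ^ 2 * (x - s) ^ 2 / (b * s + R) / ((b * x + R) ^ 2 - a * R ^ 2) := by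
      rw [← herr, sub_div, mul_div_cancel_right₀ _ hD.ne']
    rw [hstep, div_le_iff₀ hD, div_mul_eq_mul_div, div_mul_eq_mul_div]
    gcongr ?_ / _
    have h : 0 ≤ (b * x + R) * (b * x + R - a * R) + a * R * (b * s) := by
      have : 0 ≤ b * x + R - a * R := by linarith
      positivity
    have := mul_nonneg (mul_nonneg hR.le (sub_nonneg.2 hx)) h
    linarith

open Filter in
/-- Scalar version of Hewer's monotone convergence theorem: a Newton-Hewer sequence
started at or above the unique positive DARE solution `P*` is nonincreasing, bounded
below by `P*`, and converges to `P*`. -/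
theorem newton_hewer_monotone_convergence_scalar
    (A B Q R : ℝ) (hB : B ≠ 0) (hR : 0 < R) (hQ : 0 < Q)
    (Pstar : ℝ)
    (hPstar : 0 < Pstar ∧ Pstar = A^2*Pstar - A^2*B^2*Pstar^2/(B^2*Pstar + R) + Q)
    (huniq : ∀ P : ℝ, 0 < P → P = A^2*P - A^2*B^2*P^2/(B^2*P + R) + Q → P = Pstar)
    (f : ℝ → ℝ)
    (hf : ∀ P : ℝ, f P = (A^2*B^2*P^2*R + Q*(B^2*P + R)^2)/((B^2*P + R)^2 - A^2*R^2))
    (P : ℕ → ℝ) (hinit : P 1 ≥ Pstar)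
    (hiter : ∀ t : ℕ, 1 ≤ t → P (t + 1) = f (P t)) :
    (∀ t : ℕ, 1 ≤ t → P (t + 1) ≤ P t) ∧
    (∀ t : ℕ, 1 ≤ t → Pstar ≤ P t) ∧
    Tendsto P atTop (nhds Pstar) := by
  obtain ⟨hs, hdare⟩ := hPstar
  have hb : 0 < B ^ 2 := by positivity
  have hS : 0 < B ^ 2 * Pstar + R := by positivity
  have hcleared : Pstar * (B ^ 2 * Pstar + R) =
      A ^ 2 * Pstar * R + Q * (B ^ 2 * Pstar + R) := by
    field_simp at hdare
    linarith
  have hstep : ∀ x, Pstar ≤ x → Pstar ≤ f x ∧ f x ≤ x ∧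
      f x - Pstar ≤ R / (B ^ 2 * Pstar + R) * (x - Pstar) := by
    intro x hx
    rw [hf]
    exact newton_hewer_step (sq_nonneg A) hb hR hQ hs hcleared hx
  have hlower : ∀ t : ℕ, 1 ≤ t → Pstar ≤ P t := by
    intro t ht
    induction t, ht using Nat.le_induction with
    | base => exact hinit
    | succ t ht ih => rw [hiter t ht]; exact (hstep _ ih).1
  refine ⟨fun t ht => ?_, hlower, ?_⟩
  · rw [hiter t ht]
    exact (hstep _ (hlower t ht)).2.1
  have hgeom : ∀ n : ℕ, P (n + 1) ≤ Pstar + (R / (B ^ 2 * Pstar + R)) ^ n * (P 1 - Pstar) := by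
    intro n
    induction n with
    | zero => simp
    | succ n ih =>
      have hcontr := (hstep _ (hlower (n + 1) (by omega))).2.2
      rw [← hiter (n + 1) (by omega)] at hcontr
      have hmul := mul_le_mul_of_nonneg_left (sub_le_iff_le_add'.2 ih)
        (div_pos hR hS).le
      rw [pow_succ']
      linarith
  have hpow := tendsto_pow_atTop_nhds_zero_of_lt_one (div_pos hR hS).le
    ((div_lt_one hS).2 (by linarith [mul_pos hb hs]))
  rw [← tendsto_add_atTop_iff_nat 1]
  refine tendsto_of_tendsto_of_tendsto_of_le_of_le tendsto_const_nhds ?_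
    (fun n => hlower (n + 1) (by omega)) hgeom
  simpa using (hpow.mul_const (P 1 - Pstar)).const_add Pstar
end

section
/- (Failure of monotonicity of the Newton-Hewer iteration in the time-varying cost.) Let A = B = R = 1 and K₀ = √3 − 1. Run two Newton-Hewer iterations from the same gain K₀: the first with costs Q₁ = 1, Q₂ = 2, producing P₁ and P₂; the second with costs Q̂₁ = Q̂₂ = 2, producing P̂₁ and P̂₂. Then P₁ = (4√3 + 3)/6, P₂ = (63 − 28√3)/(44√3 − 71), P̂₁ = P̂₂ = 1 + √3, and one has Q₁ ≤ Q̂₁, Q₂ ≤ Q̂₂ and P₁ < P̂₁, yet P₂ > P̂₂. Hence P_t ≤ P̂_t together with Q_{t+1} ≤ Q̂_{t+1} does not imply P_{t+1} ≤ P̂_{t+1}. -/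
/-- Failure of monotonicity of the Newton-Hewer iteration in the time-varying cost:
with `A = B = R = 1`, `K₀ = √3 - 1`, costs `Q₁ = 1, Q₂ = 2` versus `Q̂₁ = Q̂₂ = 2`,
one has `Q₁ ≤ Q̂₁`, `Q₂ ≤ Q̂₂`, `P₁ < P̂₁`, and yet `P₂ > P̂₂`. -/
theorem newton_hewer_not_monotone_in_cost
    (K₀ : ℝ) (hK₀ : K₀ = Real.sqrt 3 - 1)
    (Q₁ Q₂ Qhat₁ Qhat₂ : ℝ)
    (hQ₁ : Q₁ = 1) (hQ₂ : Q₂ = 2) (hQhat₁ : Qhat₁ = 2) (hQhat₂ : Qhat₂ = 2)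
    (P₁ : ℝ) (hP₁ : P₁ = (K₀^2 + Q₁)/(1 - (1 - K₀)^2))
    (K₁ : ℝ) (hK₁ : K₁ = P₁/(P₁ + 1))
    (P₂ : ℝ) (hP₂ : P₂ = (K₁^2 + Q₂)/(1 - (1 - K₁)^2))
    (Phat₁ : ℝ) (hPhat₁ : Phat₁ = (K₀^2 + Qhat₁)/(1 - (1 - K₀)^2))
    (Khat₁ : ℝ) (hKhat₁ : Khat₁ = Phat₁/(Phat₁ + 1))
    (Phat₂ : ℝ) (hPhat₂ : Phat₂ = (Khat₁^2 + Qhat₂)/(1 - (1 - Khat₁)^2)) :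
    P₁ = (4*Real.sqrt 3 + 3)/6 ∧
    P₂ = (63 - 28*Real.sqrt 3)/(44*Real.sqrt 3 - 71) ∧
    Phat₁ = 1 + Real.sqrt 3 ∧ Phat₂ = 1 + Real.sqrt 3 ∧
    Q₁ ≤ Qhat₁ ∧ Q₂ ≤ Qhat₂ ∧ P₁ < Phat₁ ∧ P₂ > Phat₂ := by
  subst hQ₁ hQ₂ hQhat₁ hQhat₂
  set s := Real.sqrt 3
  have hs : s ^ 2 = 3 := Real.sq_sqrt (by norm_num)
  have s_nonneg : 0 ≤ s := Real.sqrt_nonneg 3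
  have s_gt : 173 / 100 < s := by nlinarith
  have s_lt : s < 174 / 100 := by nlinarith
  have hden : 1 - (1 - K₀) ^ 2 = 4 * s - 6 := by
    rw [hK₀]; linear_combination -hs
  have hden_ne : 4 * s - 6 ≠ 0 := by linarith
  have hP₁_eq : P₁ = (4 * s + 3) / 6 := by
    rw [hP₁, hden, hK₀, div_eq_iff hden_ne]
    linear_combination (-5 / 3) * hs
  have hPhat₁_eq : Phat₁ = 1 + s := by
    rw [hPhat₁, hden, hK₀, div_eq_iff hden_ne]
    linear_combination -3 * hs
  have hK₁_eq : K₁ = (8 * s - 7) / 11 := by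
    rw [hK₁, hP₁_eq, div_eq_iff (by linarith)]
    linear_combination (-16 / 33) * hs
  have hKhat₁_eq : Khat₁ = K₀ := by
    rw [hKhat₁, hPhat₁_eq, hK₀, div_eq_iff (by linarith)]
    linear_combination -hs
  have hPhat₂_eq : Phat₂ = 1 + s := by
    rw [hPhat₂, hKhat₁_eq, ← hPhat₁, hPhat₁_eq]
  have hP₂_eq : P₂ = (63 - 28 * s) / (44 * s - 71) := by
    have hnum₂ : K₁ ^ 2 + 2 = (483 - 112 * s) / 121 := by
      rw [hK₁_eq]; linear_combination (64 / 121) * hs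
    have hden₂ : 1 - (1 - K₁) ^ 2 = (288 * s - 395) / 121 := by
      rw [hK₁_eq]; linear_combination (-64 / 121) * hs
    rw [hP₂, hnum₂, hden₂, div_eq_div_iff (by linarith) (by linarith)]
    linear_combination (3136 / 121) * hs
  refine ⟨hP₁_eq, hP₂_eq, hPhat₁_eq, hPhat₂_eq, by norm_num, le_rfl, ?_, ?_⟩
  · rw [hP₁_eq, hPhat₁_eq]; linarith
  · rw [hP₂_eq, hPhat₂_eq, gt_iff_lt, lt_div_iff₀ (by linarith)]
    nlinarith
end

section
/- (Failure of monotonicity of the Newton-Hewer iteration in the initial condition.) The real numbers satisfy (1 + √5)/2 < (4√3 + 3)/6 and (55 + 53√5)/100 > (1989 + 1032√3)/(930 + 720√3). Consequently, for the two Newton-Hewer iterations with A = B = R = 1, costs Q₁ = 1, Q₂ = 11/10, and initial gains K₀ = (√5 − 1)/2 and K̂₀ = √3 − 1 respectively, one has P₁ < P̂₁ yet P₂ > P̂₂: an ordering P_t ≤ P̂_t at one time step need not be preserved at the next step when the cost parameter is time-varying. -/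
/-- One policy evaluation step at the gain `p / (p + 1)`, written in terms of `p`. -/
theorem newton_hewer_step_eq {p : ℝ} (hp : 0 < p) (q : ℝ) :
    ((p / (p + 1)) ^ 2 + q) / (1 - (1 - p / (p + 1)) ^ 2) =
      (p ^ 2 + q * (p + 1) ^ 2) / (p * (p + 2)) := by
  have hden : 1 - (1 - p / (p + 1)) ^ 2 = p * (p + 2) / (p + 1) ^ 2 := by
    field_simp
    ring
  rw [hden]
  field_simp

/-- Failure of monotonicity of the Newton-Hewer iteration in the initial condition:
`(1 + √5)/2 < (4√3 + 3)/6` and `(55 + 53√5)/100 > (1989 + 1032√3)/(930 + 720√3)`;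
hence for the two iterations with `A = B = R = 1`, `Q₁ = 1`, `Q₂ = 11/10`, started
from `K₀ = (√5 - 1)/2` and `K̂₀ = √3 - 1`, one has `P₁ < P̂₁` yet `P₂ > P̂₂`. -/
theorem newton_hewer_not_monotone_in_initial_condition
    (K₀ Khat₀ : ℝ) (hK₀ : K₀ = (Real.sqrt 5 - 1)/2) (hKhat₀ : Khat₀ = Real.sqrt 3 - 1)
    (Q₁ Q₂ : ℝ) (hQ₁ : Q₁ = 1) (hQ₂ : Q₂ = 11/10)
    (P₁ : ℝ) (hP₁ : P₁ = (K₀^2 + Q₁)/(1 - (1 - K₀)^2))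
    (K₁ : ℝ) (hK₁ : K₁ = P₁/(P₁ + 1))
    (P₂ : ℝ) (hP₂ : P₂ = (K₁^2 + Q₂)/(1 - (1 - K₁)^2))
    (Phat₁ : ℝ) (hPhat₁ : Phat₁ = (Khat₀^2 + Q₁)/(1 - (1 - Khat₀)^2))
    (Khat₁ : ℝ) (hKhat₁ : Khat₁ = Phat₁/(Phat₁ + 1))
    (Phat₂ : ℝ) (hPhat₂ : Phat₂ = (Khat₁^2 + Q₂)/(1 - (1 - Khat₁)^2)) :
    (1 + Real.sqrt 5)/2 < (4*Real.sqrt 3 + 3)/6 ∧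
    (55 + 53*Real.sqrt 5)/100 > (1989 + 1032*Real.sqrt 3)/(930 + 720*Real.sqrt 3) ∧
    P₁ < Phat₁ ∧ P₂ > Phat₂ := by
  have h5 : √5 ^ 2 = (5 : ℝ) := Real.sq_sqrt (by norm_num)
  have h3 : √3 ^ 2 = (3 : ℝ) := Real.sq_sqrt (by norm_num)
  have h5l : (2.23606 : ℝ) < √5 := Real.lt_sqrt_of_sq_lt (by norm_num)
  have h5u : √5 < (2.23607 : ℝ) := (Real.sqrt_lt' (by norm_num)).2 (by norm_num)
  have h3l : (1.73205 : ℝ) < √3 := Real.lt_sqrt_of_sq_lt (by norm_num)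
  have h3u : √3 < (1.73206 : ℝ) := (Real.sqrt_lt' (by norm_num)).2 (by norm_num)
  subst hQ₁ hQ₂ hK₀ hKhat₀ hK₁ hKhat₁
  have eP₁ : P₁ = (1 + √5) / 2 := by
    rw [hP₁, div_eq_iff (by nlinarith)]
    linear_combination ((√5 - 3) / 8) * h5
  have ePhat₁ : Phat₁ = (4 * √3 + 3) / 6 := by
    rw [hPhat₁, div_eq_iff (by nlinarith)]
    linear_combination ((4 * √3 - 7) / 6) * h3
  have eP₂ : P₂ = (55 + 53 * √5) / 100 := by
    rw [hP₂, eP₁, newton_hewer_step_eq (by positivity), div_eq_iff (by positivity)]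
    linear_combination (-(53 * √5 + 163) / 400) * h5
  have ePhat₂ : Phat₂ = (1989 + 1032 * √3) / (930 + 720 * √3) := by
    rw [hPhat₂, ePhat₁, newton_hewer_step_eq (by positivity),
      div_eq_div_iff (by positivity) (by positivity)]
    linear_combination (640 / 3 * √3 - 16) * h3
  have lt₁ : (1 + √5) / 2 < (4 * √3 + 3) / 6 := by linarith
  have lt₂ : (1989 + 1032 * √3) / (930 + 720 * √3) < (55 + 53 * √5) / 100 := by
    rw [div_lt_iff₀ (by positivity)]
    nlinarith
  exact ⟨lt₁, lt₂, by rwa [eP₁, ePhat₁], by rwa [eP₂, ePhat₂]⟩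
end
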